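/- arXiv:2310.18036 — 2 statements merged into one kernel-verified Lean document; each statement's English description precedes it below -/
import Mathlib

section
/- In a 2-cut STT, every node has at most one child that is a direct separator node. -/
open SimpleGraph

variable {V : Type*}

/-- Reachability within a vertex set `S`. -/
def reachIn (G : SimpleGraph V) (S : Set V) : V → V → Prop :=
  Relation.ReflTransGen (fun x y => x ∈ S ∧ y ∈ S ∧ G.Adj x y)

/-- The connected component of `v` inside the vertex set `S`. -/
def compIn (G : SimpleGraph V) (S : Set V) (v : V) : Set V :=
  {u | reachIn G S v u}

/-- `IsSearchTree G par S r`: the parent map `par` describes a search tree with root `r`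
on the part of `G` induced by `S`, built recursively: the root `r` is chosen, and each
connected component of `S \ {r}` carries a search tree whose root is a child of `r`. -/
inductive IsSearchTree (G : SimpleGraph V) (par : V → Option V) : Set V → V → Prop where
  | node (S : Set V) (r : V) (ρ : V → V) (hr : r ∈ S)
      (hρ : ∀ v ∈ S, v ≠ r → par (ρ v) = some r)
      (h : ∀ v ∈ S, v ≠ r → IsSearchTree G par (compIn G (S \ {r}) v) (ρ v)) :
      IsSearchTree G par S r

/-- `isAnc par a v`: `a` is an ancestor of `v` (reflexively). -/
def isAnc (par : V → Option V) (a v : V) : Prop :=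
  Relation.ReflTransGen (fun x y => par x = some y) v a

/-- The subtree rooted at `v`: all descendants of `v` (including `v`). -/
def subtree (par : V → Option V) (v : V) : Set V := {u | isAnc par v u}

/-- The outer boundary `∂(T_v)` of the subtree rooted at `v`. -/
def bdry (G : SimpleGraph V) (par : V → Option V) (v : V) : Set V :=
  {x | x ∉ subtree par v ∧ ∃ u ∈ subtree par v, G.Adj x u}

/-- A search tree is 2-cut if every subtree boundary has size at most 2. -/
def TwoCut (G : SimpleGraph V) (par : V → Option V) : Prop :=
  ∀ v, (bdry G par v).ncard ≤ 2

open Classical in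
/-- The STT rotation of `v` with its parent `p`: `p` becomes a child of `v`, `v` takes the
former parent of `p`, and any child `c` of `v` with `p ∈ ∂(T_c)` is reattached to `p`. -/
noncomputable def rotate (G : SimpleGraph V) (par : V → Option V) (v p : V) :
    V → Option V := fun x =>
  if x = v then par p
  else if x = p then some v
  else if par x = some v ∧ p ∈ bdry G par x then some p
  else par x

/-- A splay step at `x`: a single rotation if `x` has no grandparent; a ZIG-ZAG
(two rotations at `x`) if `x` is a separator; a ZIG-ZIG (rotation at the parent,
then at `x`) otherwise. -/
noncomputable def splayStep (G : SimpleGraph V) (par : V → Option V) (x : V) :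
    V → Option V :=
  match par x with
  | none => par
  | some p =>
    match par p with
    | none => rotate G par x p
    | some g =>
      if (bdry G par x).ncard = 2 then
        rotate G (rotate G par x p) x g
      else
        rotate G (rotate G par p g) x p

theorem reachIn_symm {G : SimpleGraph V} {S : Set V} {x y : V} (h : reachIn G S x y) :
    reachIn G S y x := by
  induction h with
  | refl => exact .refl
  | tail _ hs ih => exact .head ⟨hs.2.1, hs.1, hs.2.2.symm⟩ ih

theorem compIn_subset {G : SimpleGraph V} {S : Set V} {v : V} (hv : v ∈ S) :
    compIn G S v ⊆ S := by
  intro u hu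
  cases hu with
  | refl => exact hv
  | tail _ hs => exact hs.2.1

theorem reachIn_compIn_of_reachIn {G : SimpleGraph V} {S : Set V} {v u : V}
    (h : reachIn G S v u) : reachIn G (compIn G S v) v u := by
  induction h with
  | refl => exact .refl
  | tail hvu hs ih => exact ih.tail ⟨hvu, .tail hvu hs, hs.2.2⟩

theorem reachIn_of_mem_compIn {G : SimpleGraph V} {S : Set V} {v x y : V}
    (hx : x ∈ compIn G S v) (hy : y ∈ compIn G S v) : reachIn G (compIn G S v) x y :=
  (reachIn_symm (reachIn_compIn_of_reachIn hx)).trans (reachIn_compIn_of_reachIn hy)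

/-- Reachability inside a set gives reachability in any graph keeping the edges inside it. -/
theorem reachable_of_reachIn {G H : SimpleGraph V} {S : Set V} {x y : V}
    (hH : ∀ a ∈ S, ∀ b ∈ S, G.Adj a b → H.Adj a b) (h : reachIn G S x y) :
    H.Reachable x y := by
  induction h with
  | refl => exact .refl _
  | tail _ hs ih => exact ih.trans (hH _ hs.1 _ hs.2.1 hs.2.2).reachable

theorem reachIn_univ_of_reachable {G : SimpleGraph V} {x y : V} (h : G.Reachable x y) :
    reachIn G Set.univ x y := by
  obtain ⟨w⟩ := h
  induction w with
  | nil => exact .refl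
  | cons hadj _ ih => exact .head ⟨trivial, trivial, hadj⟩ ih

namespace IsSearchTree

variable {G : SimpleGraph V} {par : V → Option V} {S : Set V} {r : V}

theorem isAnc_root (h : IsSearchTree G par S r) : ∀ v ∈ S, isAnc par r v := by
  induction h with
  | node S r ρ hr hρ h ih =>
    intro v hv
    by_cases hvr : v = r
    · subst hvr
      exact .refl
    · exact (ih v hv hvr v .refl).tail (hρ v hv hvr)

theorem exists_parent_mem (h : IsSearchTree G par S r) :
    ∀ v ∈ S, v ≠ r → ∃ w ∈ S, par v = some w := by
  induction h with
  | node S r ρ hr hρ h ih =>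
    intro v hv hvr
    by_cases hroot : v = ρ v
    · exact ⟨r, hr, by rw [hroot]; exact hρ v hv hvr⟩
    · obtain ⟨w, hw, hpar⟩ := ih v hv hvr v .refl hroot
      exact ⟨w, (compIn_subset (S := S \ {r}) ⟨hv, hvr⟩ hw).1, hpar⟩

end IsSearchTree

/-- Parent chains that end in a node without a parent contain no cycles. -/
theorem not_transGen_self_of_isAnc {par : V → Option V} {r v : V} (hr : par r = none)
    (h : isAnc par r v) : ¬ Relation.TransGen (fun x y => par x = some y) v v := by
  induction h using Relation.ReflTransGen.head_induction_on with
  | refl =>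
    intro hcyc
    obtain ⟨w, hw, -⟩ := Relation.TransGen.head'_iff.mp hcyc
    simp [hr] at hw
  | head hs _ ih =>
    intro hcyc
    obtain ⟨w, hw, hrest⟩ := Relation.TransGen.head'_iff.mp hcyc
    obtain rfl : _ = w := Option.some.inj (hs.symm.trans hw)
    exact ih (.tail' hrest hs)

/-- Every subtree of a search tree on a connected child-closed set is connected. -/
theorem IsSearchTree.reachIn_subtree {G : SimpleGraph V} {par : V → Option V} {S : Set V} {r : V}
    (hacyc : ∀ v, ¬ Relation.TransGen (fun x y => par x = some y) v v)
    (h : IsSearchTree G par S r) :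
    (∀ x ∈ S, ∀ y, par y = some x → y ∈ S) →
    (∀ x ∈ S, ∀ y ∈ S, reachIn G S x y) →
    ∀ v ∈ S, ∀ x ∈ subtree par v, ∀ y ∈ subtree par v, reachIn G (subtree par v) x y := by
  induction h with
  | node S r ρ hr hρ h ih =>
    intro hclosed hconn v hv
    by_cases hvr : v = r
    · subst hvr
      have hS : subtree par v = S := by
        apply Set.Subset.antisymm
        · intro u hu
          induction hu using Relation.ReflTransGen.head_induction_on with
          | refl => exact hr
          | head hs _ ih => exact hclosed _ ih _ hs
        · exact (IsSearchTree.node S v ρ hr hρ h).isAnc_root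
      rwa [hS]
    · refine ih v hv hvr ?_ (fun x hx y hy => reachIn_of_mem_compIn hx hy) v .refl
      intro x hx y hy
      have hxS := compIn_subset (S := S \ {r}) ⟨hv, hvr⟩ hx
      have hyS : y ∈ S := hclosed x hxS.1 y hy
      have hyr : y ≠ r := by
        rintro rfl
        exact hacyc y (.head' hy ((IsSearchTree.node S y ρ hr hρ h).isAnc_root x hxS.1))
      have hyρ : y ≠ ρ y := by
        intro heq
        have hpar := hρ y hyS hyr
        rw [← heq, hy] at hpar
        exact hxS.2 (Option.some.inj hpar)
      obtain ⟨w, hw, hpar⟩ := (h y hyS hyr).exists_parent_mem y .refl hyρ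
      obtain rfl : x = w := Option.some.inj (hy.symm.trans hpar)
      exact Relation.ReflTransGen.trans hx (reachIn_symm hw)

/-- The subtrees of distinct siblings are disjoint. -/
theorem disjoint_subtree_of_par_eq {par : V → Option V} {p c c' : V}
    (hacyc : ∀ v, ¬ Relation.TransGen (fun x y => par x = some y) v v)
    (hc : par c = some p) (hc' : par c' = some p) (hne : c ≠ c') :
    Disjoint (subtree par c) (subtree par c') := by
  have not_isAnc : ∀ {a b : V}, par a = some p → par b = some p → a ≠ b → ¬ isAnc par a b := by
    intro a b ha hb hab hanc
    rcases Relation.ReflTransGen.cases_head hanc with heq | ⟨w, hw, hrest⟩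
    · exact hab heq.symm
    · obtain rfl : p = w := Option.some.inj (hb.symm.trans hw)
      exact hacyc p (.tail' hrest ha)
  rw [Set.disjoint_left]
  intro u hu hu'
  have hunique : Relator.RightUnique (fun x y => par x = some y) :=
    fun _ _ _ h₁ h₂ => Option.some.inj (h₁.symm.trans h₂)
  rcases Relation.ReflTransGen.total_of_right_unique hunique hu hu' with h | h
  · exact not_isAnc hc' hc hne.symm h
  · exact not_isAnc hc hc' hne h

/-- In an acyclic graph, two disjoint connected sets have at most one common outer neighbor. -/
theorem SimpleGraph.IsAcyclic.eq_of_common_neighbors {G : SimpleGraph V} (hG : G.IsAcyclic)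
    {A B : Set V} (hAB : Disjoint A B)
    (hA : ∀ x ∈ A, ∀ y ∈ A, reachIn G A x y) (hB : ∀ x ∈ B, ∀ y ∈ B, reachIn G B x y)
    {p q : V} (hpA : p ∉ A) (hpB : p ∉ B)
    (hpA' : ∃ a ∈ A, G.Adj p a) (hqA' : ∃ a ∈ A, G.Adj q a)
    (hpB' : ∃ b ∈ B, G.Adj p b) (hqB' : ∃ b ∈ B, G.Adj q b) : p = q := by
  by_contra hpq
  obtain ⟨a, ha, hpa⟩ := hpA'
  obtain ⟨a', ha', hqa⟩ := hqA'
  obtain ⟨b, hb, hpb⟩ := hpB'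
  obtain ⟨b', hb', hqb⟩ := hqB'
  have hbridge := isBridge_iff.mp (isAcyclic_iff_forall_adj_isBridge.mp hG hpa)
  have hAdj : ∀ {x y : V}, G.Adj x y → s(x, y) ≠ s(p, a) →
      (G.deleteEdges {s(p, a)}).Adj x y := by
    intro x y hxy hne
    simpa [deleteEdges_adj, hxy] using hne
  have haa' : (G.deleteEdges {s(p, a)}).Reachable a a' :=
    reachable_of_reachIn (S := A) (fun x hx y hy hxy => hAdj hxy (by grind)) (hA a ha a' ha')
  have hbb' : (G.deleteEdges {s(p, a)}).Reachable b b' :=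
    reachable_of_reachIn (S := B) (fun x hx y hy hxy => hAdj hxy (by grind)) (hB b hb b' hb')
  have hba : b ≠ a := fun h => Set.disjoint_left.mp hAB ha (h ▸ hb)
  have hpb_reach := (hAdj hpb (by grind)).reachable
  have hqb_reach := (hAdj hqb (by grind)).reachable
  have hqa_reach := (hAdj hqa (by grind)).reachable
  exact hbridge (hpb_reach.trans (hbb'.trans (hqb_reach.symm.trans (hqa_reach.trans haa'.symm))))

/-- In a 2-cut STT, every node has at most one child that is a direct
separator node (a child `c` with `∂(T_c) = {p, g}`, where `g` is the parent of `p`). -/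
theorem at_most_one_direct_separator_child [Fintype V] (G : SimpleGraph V)
    (hG : G.IsTree) (par : V → Option V) (r : V) (hroot : par r = none)
    (hT : IsSearchTree G par Set.univ r) (h2 : TwoCut G par)
    (p c c' : V) (hc : par c = some p) (hc' : par c' = some p)
    (hd : ∃ g, par p = some g ∧ bdry G par c = {p, g})
    (hd' : ∃ g, par p = some g ∧ bdry G par c' = {p, g}) :
    c = c' := by 
  by_contra hne
  obtain ⟨g, hg, hbd⟩ := hd
  obtain ⟨g', hg', hbd'⟩ := hd'
  obtain rfl : g = g' := Option.some.inj (hg.symm.trans hg')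
  have hacyc : ∀ v, ¬ Relation.TransGen (fun x y => par x = some y) v v :=
    fun v => not_transGen_self_of_isAnc hroot (hT.isAnc_root v trivial)
  have hconn := hT.reachIn_subtree hacyc (fun _ _ _ _ => trivial)
    (fun x _ y _ => reachIn_univ_of_reachable (hG.connected.preconnected x y))
  have hp : p ∈ bdry G par c := by simp [hbd]
  have hq : g ∈ bdry G par c := by simp [hbd]
  have hp' : p ∈ bdry G par c' := by simp [hbd']
  have hq' : g ∈ bdry G par c' := by simp [hbd']
  have hpg : p = g := hG.isAcyclic.eq_of_common_neighbors
    (disjoint_subtree_of_par_eq hacyc hc hc' hne) (hconn c trivial) (hconn c' trivial)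
    hp.1 hp'.1 hp.2 hq.2 hp'.2 hq'.2
  subst hpg
  exact hacyc p (.single hg)
end

section
/- Let T be a 2-cut STT and let v be a node with parent p. Rotating v with p yields a 2-cut STT if and only if |∂(T_v)| ≠ 1 or |∂(T_p)| ≠ 2. -/
open SimpleGraph

variable {V : Type*}

theorem isAnc_of_par {par : V → Option V} {a x y : V} (hxy : par x = some y)
    (h : isAnc par a y) : isAnc par a x :=
  Relation.ReflTransGen.head hxy h

theorem isAnc_par_of_ne {par : V → Option V} {a x y : V} (hxy : par x = some y)
    (h : isAnc par a x) (hne : x ≠ a) : isAnc par a y := by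
  rcases Relation.ReflTransGen.cases_head h with h | ⟨z, hz, h⟩
  · exact absurd h hne
  · have : y = z := Option.some.inj (hxy.symm.trans hz)
    exact this ▸ h

theorem isAnc_total {par : V → Option V} {a b x : V} (ha : isAnc par a x)
    (hb : isAnc par b x) : isAnc par b a ∨ isAnc par a b :=
  Relation.ReflTransGen.total_of_right_unique
    (fun _ _ _ h h' => Option.some.inj (h.symm.trans h')) ha hb

theorem isAnc.induction {par : V → Option V} {a : V} {P : V → Prop} (base : P a)
    (step : ∀ x y, par x = some y → isAnc par a y → P y → P x) {x : V}
    (h : isAnc par a x) : P x :=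
  Relation.ReflTransGen.head_induction_on h base (fun h h' ih => step _ _ h h' ih)

theorem reachIn_compIn {G : SimpleGraph V} {S : Set V} {v x : V} (h : x ∈ compIn G S v) :
    reachIn G (compIn G S v) v x := by
  have h' : reachIn G S v x := h
  induction h' with
  | refl => exact Relation.ReflTransGen.refl
  | tail hab hbc ih =>
    exact (ih hab).tail ⟨hab, hab.tail hbc, hbc.2.2⟩

theorem exists_adj_crossing {G : SimpleGraph V} {S A : Set V} {x y : V}
    (h : reachIn G S x y) (hx : x ∈ A) (hy : y ∉ A) :
    ∃ a b, a ∈ S ∧ b ∈ S ∧ G.Adj a b ∧ a ∈ A ∧ b ∉ A := by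
  induction h with
  | refl => exact absurd hx hy
  | @tail b c _ hbc ih =>
    by_cases hb : b ∈ A
    · exact ⟨b, c, hbc.1, hbc.2.1, hbc.2.2, hb, hy⟩
    · exact ih hb

theorem exists_walk_of_reachIn {G : SimpleGraph V} {S : Set V} {x y : V}
    (h : reachIn G S x y) (hx : x ∈ S) : ∃ w : G.Walk x y, ∀ z ∈ w.support, z ∈ S := by
  induction h with
  | refl => exact ⟨Walk.nil, by simpa using hx⟩
  | tail _ hbc ih =>
    obtain ⟨w, hw⟩ := ih
    refine ⟨w.concat hbc.2.2, fun z hz => ?_⟩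
    simp only [Walk.support_concat, List.mem_append, List.mem_singleton] at hz
    rcases hz with hz | rfl
    · exact hw z hz
    · exact hbc.2.1

/-- In a forest, a vertex outside a connected set has at most one neighbour in it. -/
theorem SimpleGraph.IsAcyclic.neighbor_unique {G : SimpleGraph V} (hG : G.IsAcyclic)
    {S : Set V} {a u w : V} (ha : a ∉ S) (hu : u ∈ S) (hr : reachIn G S u w)
    (hau : G.Adj a u) (haw : G.Adj a w) : u = w := by
  classical
  by_contra hne
  obtain ⟨q, hq⟩ := exists_walk_of_reachIn hr hu
  have hpath : (Walk.cons hau.symm (Walk.cons haw Walk.nil)).IsPath := by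
    simp [Walk.isPath_def, hau.ne', haw.ne, hne]
  have heq := (hG.subsingleton_path u w).elim ⟨_, hpath⟩ q.toPath
  have hmem : a ∈ (q.toPath : G.Walk u w).support := by
    rw [← heq]; simp
  exact ha (hq a (q.support_bypass_subset_support hmem))

theorem IsSearchTree.root_mem {G : SimpleGraph V} {par : V → Option V} {S : Set V} {s : V}
    (h : IsSearchTree G par S s) : s ∈ S := by
  cases h; assumption

theorem IsSearchTree.isAnc_root_s11 {G : SimpleGraph V} {par : V → Option V} {S : Set V} {s : V}
    (h : IsSearchTree G par S s) : ∀ u ∈ S, isAnc par s u := by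
  induction h with
  | node S s ρ hr hρ h ih =>
    intro u hu
    by_cases hus : u = s
    · exact hus ▸ Relation.ReflTransGen.refl
    · exact (ih u hu hus u Relation.ReflTransGen.refl).tail (hρ u hu hus)

/-- The order-theoretic properties of a search tree on `G`: the parent map has no cycles,
subtrees are connected, and adjacent vertices are comparable. -/
structure IsSearchOrder (G : SimpleGraph V) (par : V → Option V) : Prop where
  acyclic : ∀ x y, par x = some y → ¬ isAnc par x y
  connected : ∀ u x y, isAnc par u x → isAnc par u y → reachIn G (subtree par u) x y
  comparable : ∀ x y, G.Adj x y → isAnc par x y ∨ isAnc par y x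

theorem acyclic_of_isAnc_root {par : V → Option V} {r : V} (hroot : par r = none)
    (hr : ∀ u, isAnc par r u) (x y : V) (hxy : par x = some y) : ¬ isAnc par x y := by
  refine isAnc.induction (P := fun x => ∀ y, par x = some y → ¬ isAnc par x y) ?_ ?_ (hr x) y hxy
  · intro y hy
    simp [hroot] at hy
  · intro x z hxz _ ih y hxy hanc
    obtain rfl : z = y := Option.some.inj (hxz.symm.trans hxy)
    rcases Relation.ReflTransGen.cases_head hanc with rfl | ⟨t, ht, hanc'⟩
    · exact ih _ hxy hanc
    · exact ih t ht (hanc'.tail hxy)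

theorem IsSearchTree.connected_and_comparable {G : SimpleGraph V} {par : V → Option V}
    (hac : ∀ x y, par x = some y → ¬ isAnc par x y) {S : Set V} {s : V}
    (h : IsSearchTree G par S s) (hS : subtree par s = S)
    (hconn : ∀ x ∈ S, ∀ y ∈ S, reachIn G S x y) :
    (∀ u ∈ S, ∀ x y, isAnc par u x → isAnc par u y → reachIn G (subtree par u) x y) ∧
      ∀ x ∈ S, ∀ y ∈ S, G.Adj x y → isAnc par x y ∨ isAnc par y x := by
  induction h with
  | node S s ρ hr hρ h ih =>
    have hsub : ∀ v (hv : v ∈ S) (hvs : v ≠ s),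
        subtree par (ρ v) = compIn G (S \ {s}) v := by
      intro v hv hvs
      refine Set.Subset.antisymm (fun x hx => ?_) (fun x hx => (h v hv hvs).isAnc_root_s11 x hx)
      have hxS : x ∈ S := hS ▸ Relation.ReflTransGen.tail hx (hρ v hv hvs)
      have hxs : x ≠ s := by
        rintro rfl
        exact hac _ _ (hρ v hv hvs) hx
      have hcx : isAnc par (ρ x) x :=
        (h x hxS hxs).isAnc_root_s11 x Relation.ReflTransGen.refl
      have hc : ρ v = ρ x := by
        by_contra hne
        rcases isAnc_total hx hcx with hanc | hanc
        · exact hac _ _ (hρ x hxS hxs) (isAnc_par_of_ne (hρ v hv hvs) hanc hne)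
        · exact hac _ _ (hρ v hv hvs) (isAnc_par_of_ne (hρ x hxS hxs) hanc (Ne.symm hne))
      have h1 : reachIn G (S \ {s}) v (ρ v) := (h v hv hvs).root_mem
      have h2 : reachIn G (S \ {s}) x (ρ x) := (h x hxS hxs).root_mem
      rw [← hc] at h2
      exact h1.trans (reachIn_symm h2)
    have key := fun v hv hvs => ih v hv hvs (hsub v hv hvs)
      (fun x hx y hy => (reachIn_symm (reachIn_compIn hx)).trans (reachIn_compIn hy))
    refine ⟨fun u hu x y hx hy => ?_, fun x hx y hy hxy => ?_⟩
    · by_cases hus : u = s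
      · subst hus
        rw [hS]
        exact hconn x (hS ▸ hx) y (hS ▸ hy)
      · exact (key u hu hus).1 u Relation.ReflTransGen.refl x y hx hy
    · by_cases hxs : x = s
      · subst hxs
        exact Or.inl (show y ∈ subtree par x from hS ▸ hy)
      · by_cases hys : y = s
        · subst hys
          exact Or.inr (show x ∈ subtree par y from hS ▸ hx)
        · exact (key x hx hxs).2 x Relation.ReflTransGen.refl y
            (Relation.ReflTransGen.single ⟨⟨hx, hxs⟩, ⟨hy, hys⟩, hxy⟩) hxy

theorem IsSearchTree.isSearchOrder {G : SimpleGraph V} (hG : G.Connected)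
    {par : V → Option V} {r : V} (hroot : par r = none)
    (hT : IsSearchTree G par Set.univ r) : IsSearchOrder G par := by
  have hr : ∀ u, isAnc par r u := fun u => hT.isAnc_root_s11 u trivial
  have hac := acyclic_of_isAnc_root hroot hr
  have hconn : ∀ x ∈ Set.univ, ∀ y ∈ Set.univ, reachIn G Set.univ x y := by
    intro x _ y _
    obtain ⟨w⟩ := hG.preconnected x y
    induction w with
    | nil => exact Relation.ReflTransGen.refl
    | cons hadj _ ih => exact Relation.ReflTransGen.head ⟨trivial, trivial, hadj⟩ (ih trivial trivial)
  obtain ⟨h1, h2⟩ := hT.connected_and_comparable hac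
    (Set.eq_univ_of_forall fun u => hr u) hconn
  exact ⟨hac, fun u => h1 u trivial, fun x y => h2 x trivial y trivial⟩

namespace IsSearchOrder

variable {G : SimpleGraph V} {par : V → Option V}

theorem antisymm (h : IsSearchOrder G par) {x y : V} (hxy : isAnc par x y)
    (hyx : isAnc par y x) : x = y := by
  rcases Relation.ReflTransGen.cases_head hxy with h' | ⟨z, hz, hxz⟩
  · exact h'.symm
  · exact absurd (Relation.ReflTransGen.trans hxz hyx) (h.acyclic y z hz)

theorem isAnc_of_mem_bdry (h : IsSearchOrder G par) {a v : V} (ha : a ∈ bdry G par v) :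
    isAnc par a v := by
  obtain ⟨hav, u, hu, hadj⟩ := ha
  rcases h.comparable a u hadj with hau | hua
  · exact (isAnc_total hau hu).elim (fun hva => absurd hva hav) id
  · exact absurd (Relation.ReflTransGen.trans hua hu) hav

theorem par_mem_bdry (h : IsSearchOrder G par) {v p : V} (hvp : par v = some p) :
    p ∈ bdry G par v := by
  have hp : p ∉ subtree par v := h.acyclic v p hvp
  obtain ⟨a, b, -, hb, hab, hav, hbv⟩ := exists_adj_crossing
    (h.connected p v p (isAnc_of_par hvp Relation.ReflTransGen.refl) Relation.ReflTransGen.refl)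
    (A := subtree par v) Relation.ReflTransGen.refl hp
  have hbd : b ∈ bdry G par v := ⟨hbv, a, hav, hab.symm⟩
  have hbp : isAnc par b p := by
    refine isAnc_par_of_ne hvp (h.isAnc_of_mem_bdry hbd) ?_
    rintro rfl
    exact hbv Relation.ReflTransGen.refl
  exact h.antisymm hbp hb ▸ hbd

end IsSearchOrder

section Rotate

variable {G : SimpleGraph V} {par : V → Option V} {v p : V}

theorem rotate_self : rotate G par v p v = par p := by simp [rotate]

theorem rotate_parent (hne : p ≠ v) : rotate G par v p p = some v := by simp [rotate, hne]

theorem rotate_reattached {c : V} (hcv : c ≠ v) (hcp : c ≠ p) (hc : par c = some v)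
    (hpc : p ∈ bdry G par c) : rotate G par v p c = some p := by
  simp [rotate, hcv, hcp, hc, hpc]

theorem rotate_of_not_reattached {x : V} (hxv : x ≠ v) (hxp : x ≠ p)
    (h : ¬ (par x = some v ∧ p ∈ bdry G par x)) : rotate G par v p x = par x := by
  simp only [rotate, hxv, hxp, h, if_false]

theorem subtree_rotate_of_ne (hvp : par v = some p) (hpv : p ≠ v) {z : V} (hzv : z ≠ v)
    (hzp : z ≠ p) : subtree (rotate G par v p) z = subtree par z := by
  ext y
  constructor
  · intro hy
    refine isAnc.induction (P := fun y => isAnc par z y) Relation.ReflTransGen.refl ?_ hy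
    intro x w hxw _ ih
    by_cases hxv : x = v
    · subst hxv
      rw [rotate_self] at hxw
      exact isAnc_of_par hvp (isAnc_of_par hxw ih)
    by_cases hxp : x = p
    · subst hxp
      rw [rotate_parent hpv] at hxw
      cases hxw
      exact isAnc_par_of_ne hvp ih hzv.symm
    by_cases hc : par x = some v ∧ p ∈ bdry G par x
    · rw [rotate_reattached hxv hxp hc.1 hc.2] at hxw
      cases hxw
      exact isAnc_of_par hc.1 (isAnc_of_par hvp ih)
    · rw [rotate_of_not_reattached hxv hxp hc] at hxw
      exact isAnc_of_par hxw ih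
  · intro hy
    refine isAnc.induction (P := fun y => isAnc (rotate G par v p) z y)
      Relation.ReflTransGen.refl ?_ hy
    intro x w hxw _ ih
    have hp := rotate_parent (G := G) (par := par) hpv
    by_cases hxv : x = v
    · subst hxv
      rw [hvp] at hxw
      cases hxw
      exact isAnc_par_of_ne hp ih hzp.symm
    by_cases hxp : x = p
    · subst hxp
      exact isAnc_of_par hp (isAnc_of_par (rotate_self.trans hxw) ih)
    by_cases hc : par x = some v ∧ p ∈ bdry G par x
    · rw [hc.1] at hxw
      cases hxw
      exact isAnc_of_par (rotate_reattached hxv hxp hc.1 hc.2) (isAnc_of_par hp ih)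
    · exact isAnc_of_par ((rotate_of_not_reattached hxv hxp hc).trans hxw) ih

theorem subtree_rotate_self (hvp : par v = some p) (hpv : p ≠ v) :
    subtree (rotate G par v p) v = subtree par p := by
  have hv : isAnc par p v := isAnc_of_par hvp Relation.ReflTransGen.refl
  have hp : isAnc (rotate G par v p) v p :=
    isAnc_of_par (rotate_parent hpv) Relation.ReflTransGen.refl
  ext y
  constructor
  · intro hy
    refine isAnc.induction (P := fun y => isAnc par p y) hv ?_ hy
    intro x w hxw _ ih
    by_cases hxv : x = v
    · exact hxv ▸ hv
    by_cases hxp : x = p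
    · exact hxp ▸ Relation.ReflTransGen.refl
    by_cases hc : par x = some v ∧ p ∈ bdry G par x
    · exact isAnc_of_par hc.1 hv
    · rw [rotate_of_not_reattached hxv hxp hc] at hxw
      exact isAnc_of_par hxw ih
  · intro hy
    refine isAnc.induction (P := fun y => isAnc (rotate G par v p) v y) hp ?_ hy
    intro x w hxw _ ih
    by_cases hxv : x = v
    · exact hxv ▸ Relation.ReflTransGen.refl
    by_cases hxp : x = p
    · exact hxp ▸ hp
    by_cases hc : par x = some v ∧ p ∈ bdry G par x
    · exact isAnc_of_par (rotate_reattached hxv hxp hc.1 hc.2) hp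
    · exact isAnc_of_par ((rotate_of_not_reattached hxv hxp hc).trans hxw) ih

namespace IsSearchOrder

theorem par_ne (h : IsSearchOrder G par) (hvp : par v = some p) : p ≠ v := by
  rintro rfl
  exact h.acyclic _ _ hvp Relation.ReflTransGen.refl

theorem mem_subtree_rotate_parent_iff (h : IsSearchOrder G par) (hvp : par v = some p) {y : V} :
    y ∈ subtree (rotate G par v p) p ↔
      (isAnc par p y ∧ ¬ isAnc par v y) ∨
        ∃ c, par c = some v ∧ p ∈ bdry G par c ∧ isAnc par c y := by
  have hpv := h.par_ne hvp
  have hbase : isAnc par p p ∧ ¬ isAnc par v p :=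
    ⟨Relation.ReflTransGen.refl, h.acyclic v p hvp⟩
  constructor
  · intro hy
    refine isAnc.induction (P := fun y => (isAnc par p y ∧ ¬ isAnc par v y) ∨
        ∃ c, par c = some v ∧ p ∈ bdry G par c ∧ isAnc par c y) (Or.inl hbase) ?_ hy
    intro x w hxw _ ih
    by_cases hxv : x = v
    · subst hxv
      rw [rotate_self] at hxw
      have hpw : isAnc par p w := by
        rcases ih with ih | ⟨c, hc, -, hcw⟩
        · exact ih.1
        · exact Relation.ReflTransGen.tail (Relation.ReflTransGen.tail hcw hc) hvp
      exact absurd hpw (h.acyclic p w hxw)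
    by_cases hxp : x = p
    · subst hxp
      exact Or.inl hbase
    by_cases hc : par x = some v ∧ p ∈ bdry G par x
    · exact Or.inr ⟨x, hc.1, hc.2, Relation.ReflTransGen.refl⟩
    · rw [rotate_of_not_reattached hxv hxp hc] at hxw
      rcases ih with ih | ⟨c, hc, hpc, hcw⟩
      · exact Or.inl ⟨isAnc_of_par hxw ih.1, fun hvx => ih.2 (isAnc_par_of_ne hxw hvx hxv)⟩
      · exact Or.inr ⟨c, hc, hpc, isAnc_of_par hxw hcw⟩
  · rintro (⟨hpy, hvy⟩ | ⟨c, hc, hpc, hcy⟩)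
    · refine isAnc.induction
        (P := fun y => ¬ isAnc par v y → isAnc (rotate G par v p) p y)
        (fun _ => Relation.ReflTransGen.refl) ?_ hpy hvy
      intro x w hxw _ ih hvx
      have hxv : x ≠ v := by
        rintro rfl
        exact hvx Relation.ReflTransGen.refl
      by_cases hxp : x = p
      · exact hxp ▸ Relation.ReflTransGen.refl
      have hc : ¬ (par x = some v ∧ p ∈ bdry G par x) := fun hc =>
        hvx (isAnc_of_par hc.1 Relation.ReflTransGen.refl)
      exact isAnc_of_par ((rotate_of_not_reattached hxv hxp hc).trans hxw)
        (ih fun hvw => hvx (isAnc_of_par hxw hvw))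
    · have hcv : c ≠ v := (h.par_ne hc).symm
      have hcp : c ≠ p := by
        rintro rfl
        exact hpc.1 Relation.ReflTransGen.refl
      have hcy' : y ∈ subtree (rotate G par v p) c :=
        (subtree_rotate_of_ne hvp hpv hcv hcp).symm ▸ hcy
      exact Relation.ReflTransGen.tail hcy' (rotate_reattached hcv hcp hc hpc)

theorem subtree_rotate_parent_subset (h : IsSearchOrder G par) (hvp : par v = some p) :
    subtree (rotate G par v p) p ⊆ subtree par p := by
  intro y hy
  rcases (h.mem_subtree_rotate_parent_iff hvp).1 hy with hy | ⟨c, hc, -, hcy⟩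
  · exact hy.1
  · exact Relation.ReflTransGen.tail (Relation.ReflTransGen.tail hcy hc) hvp

theorem notMem_subtree_rotate_parent (h : IsSearchOrder G par) (hvp : par v = some p) :
    v ∉ subtree (rotate G par v p) p := by
  intro hv
  rcases (h.mem_subtree_rotate_parent_iff hvp).1 hv with hv | ⟨c, hc, -, hcv⟩
  · exact hv.2 Relation.ReflTransGen.refl
  · exact h.acyclic c v hc hcv

/-- The only vertex of the old subtree of `p` on the boundary of its new subtree is `v`. -/
theorem eq_of_adj_subtree_rotate_parent (h : IsSearchOrder G par) (hvp : par v = some p)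
    {x y : V} (hx : x ∈ subtree (rotate G par v p) p) (hyp : y ∈ subtree par p)
    (hy : y ∉ subtree (rotate G par v p) p) (hxy : G.Adj x y) : y = v := by
  by_contra hyv
  rw [h.mem_subtree_rotate_parent_iff hvp] at hx hy
  push Not at hy
  have hvy : isAnc par v y := by
    by_contra hvy
    exact hvy (hy.1 hyp)
  obtain ⟨d, hd, hdv⟩ : ∃ d, isAnc par d y ∧ par d = some v := by
    rcases Relation.ReflTransGen.cases_tail hvy with hvy | ⟨d, hd, hdv⟩
    · exact absurd hvy.symm hyv
    · exact ⟨d, hd, hdv⟩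
  rcases hx with ⟨hpx, hvx⟩ | ⟨c, hc, hpc, hcx⟩
  · have hxd : x ∈ bdry G par d :=
      ⟨fun hdx => hvx (Relation.ReflTransGen.tail hdx hdv), y, hd, hxy⟩
    have hxv : isAnc par x v := isAnc_par_of_ne hdv (h.isAnc_of_mem_bdry hxd) fun hdx =>
      hxd.1 (hdx ▸ Relation.ReflTransGen.refl)
    have hxp : isAnc par x p := isAnc_par_of_ne hvp hxv fun hvx' =>
      hvx (hvx' ▸ Relation.ReflTransGen.refl)
    exact hy.2 d hdv (h.antisymm hxp hpx ▸ hxd) hd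
  · have hcd : c ≠ d := by
      rintro rfl
      exact hy.2 c hc hpc hd
    have hnot : ∀ z, isAnc par c z → ¬ isAnc par d z := fun z hcz hdz =>
      (isAnc_total hcz hdz).elim
        (fun hdc => h.acyclic d v hdv (isAnc_par_of_ne hc hdc hcd))
        (fun hcd' => h.acyclic c v hc (isAnc_par_of_ne hdv hcd' hcd.symm))
    rcases h.comparable x y hxy with hxy | hyx
    · exact hnot y (Relation.ReflTransGen.trans hxy hcx) hd
    · exact hnot x hcx (Relation.ReflTransGen.trans hyx hd)

theorem bdry_rotate_parent_subset (h : IsSearchOrder G par) (hvp : par v = some p) :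
    bdry G (rotate G par v p) p ⊆ insert v (bdry G par p) := by
  rintro y ⟨hy, x, hx, hyx⟩
  by_cases hyp : y ∈ subtree par p
  · exact Or.inl (h.eq_of_adj_subtree_rotate_parent hvp hx hyp hy hyx.symm)
  · exact Or.inr ⟨hyp, x, h.subtree_rotate_parent_subset hvp hx, hyx⟩

theorem mem_bdry_rotate_parent (h : IsSearchOrder G par) (hvp : par v = some p) :
    v ∈ bdry G (rotate G par v p) p := by
  have hv := h.notMem_subtree_rotate_parent hvp
  obtain ⟨a, b, -, hb, hab, hap, hbp⟩ := exists_adj_crossing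
    (h.connected p p v Relation.ReflTransGen.refl (isAnc_of_par hvp Relation.ReflTransGen.refl))
    (A := subtree (rotate G par v p) p) Relation.ReflTransGen.refl hv
  obtain rfl := h.eq_of_adj_subtree_rotate_parent hvp hap hb hbp hab
  exact ⟨hv, a, hap, hab.symm⟩

theorem mem_bdry_parent (h : IsSearchOrder G par) (hvp : par v = some p) {a : V}
    (ha : a ∈ bdry G par v) (hap : a ≠ p) : a ∈ bdry G par p := by
  have hanc : isAnc par a p := isAnc_par_of_ne hvp (h.isAnc_of_mem_bdry ha) fun hva =>
    ha.1 (hva ▸ Relation.ReflTransGen.refl)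
  obtain ⟨u, hu, hau⟩ := ha.2
  exact ⟨fun hpa => hap (h.antisymm hanc hpa), u, Relation.ReflTransGen.tail hu hvp, hau⟩

/-- In a 2-cut search tree on a forest, a boundary vertex shared by `v` and its parent leaves
the boundary of the parent when the two are rotated. -/
theorem notMem_bdry_rotate_parent [Finite V] (h : IsSearchOrder G par) (hG : G.IsAcyclic)
    (h2 : TwoCut G par) (hvp : par v = some p) {a : V} (ha : a ∈ bdry G par v) (hap : a ≠ p) :
    a ∉ bdry G (rotate G par v p) p := by
  rintro ⟨-, w, hw, haw⟩
  have hap' := h.mem_bdry_parent hvp ha hap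
  obtain ⟨hav, u, hu, hau⟩ := ha
  have hup : isAnc par p u := Relation.ReflTransGen.tail hu hvp
  obtain rfl : u = w := hG.neighbor_unique hap'.1 hup
    (h.connected p u w hup (h.subtree_rotate_parent_subset hvp hw)) hau haw
  rcases (h.mem_subtree_rotate_parent_iff hvp).1 hw with hw | ⟨c, hc, hpc, hcu⟩
  · exact hw.2 hu
  · have hvc := h.par_mem_bdry hc
    have hac : a ∈ bdry G par c := ⟨fun hca => hav (Relation.ReflTransGen.tail hca hc), u, hcu, hau⟩
    have hav' : a ≠ v := by
      rintro rfl
      exact hav Relation.ReflTransGen.refl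
    have hlt : 2 < (bdry G par c).ncard := (Set.two_lt_ncard (Set.toFinite _)).2
      ⟨a, hac, v, hvc, p, hpc, hav', hap, (h.par_ne hvp).symm⟩
    exact absurd (h2 c) (by omega)

theorem twoCut_rotate_iff (h : IsSearchOrder G par) (h2 : TwoCut G par)
    (hvp : par v = some p) :
    TwoCut G (rotate G par v p) ↔ (bdry G (rotate G par v p) p).ncard ≤ 2 := by
  refine ⟨fun h' => h' p, fun hp x => ?_⟩
  have hpv := h.par_ne hvp
  by_cases hxp : x = p
  · exact hxp ▸ hp
  by_cases hxv : x = v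
  · have : bdry G (rotate G par v p) v = bdry G par p := by
      simp only [bdry, subtree_rotate_self hvp hpv]
    rw [hxv, this]
    exact h2 p
  · have : bdry G (rotate G par v p) x = bdry G par x := by
      simp only [bdry, subtree_rotate_of_ne hvp hpv hxv hxp]
    exact this ▸ h2 x

end IsSearchOrder

end Rotate

/-- In a 2-cut STT, rotating `v` with its parent `p` preserves the
2-cut property if and only if `|∂(T_v)| ≠ 1` or `|∂(T_p)| ≠ 2`. -/
theorem rotation_preserves_twoCut_iff [Fintype V] (G : SimpleGraph V) (hG : G.IsTree)
    (par : V → Option V) (r : V) (hroot : par r = none)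
    (hT : IsSearchTree G par Set.univ r) (h2 : TwoCut G par)
    (v p : V) (hvp : par v = some p) :
    TwoCut G (rotate G par v p) ↔
      ((bdry G par v).ncard ≠ 1 ∨ (bdry G par p).ncard ≠ 2) := by
  have h := hT.isSearchOrder hG.connected hroot
  have hpv : p ∈ bdry G par v := h.par_mem_bdry hvp
  rw [h.twoCut_rotate_iff h2 hvp]
  constructor
  · intro hle
    by_contra! hcon
    obtain ⟨q, hq⟩ := Set.ncard_eq_one.1 hcon.1
    have hsub : insert v (bdry G par p) ⊆ bdry G (rotate G par v p) p := by
      refine Set.insert_subset (h.mem_bdry_rotate_parent hvp) ?_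
      rintro a ⟨hap, u, hu, hau⟩
      have hvu : ¬ isAnc par v u := by
        intro hvu
        have hav : a ∈ bdry G par v :=
          ⟨fun hva => hap (Relation.ReflTransGen.tail hva hvp), u, hvu, hau⟩
        rw [hq] at hav hpv
        exact hap ((hav.trans hpv.symm : a = p) ▸ Relation.ReflTransGen.refl)
      exact ⟨fun ha => hap (h.subtree_rotate_parent_subset hvp ha), u,
        (h.mem_subtree_rotate_parent_iff hvp).2 (Or.inl ⟨hu, hvu⟩), hau⟩
    have hv : v ∉ bdry G par p := fun hv => hv.1 (isAnc_of_par hvp Relation.ReflTransGen.refl)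
    have hcard := Set.ncard_le_ncard hsub (Set.toFinite _)
    rw [Set.ncard_insert_of_notMem hv (Set.toFinite _)] at hcard
    omega
  · intro hor
    by_cases hp : (bdry G par p).ncard = 2
    · obtain ⟨a, ha, hap⟩ : ∃ a ∈ bdry G par v, a ≠ p := by
        by_contra! hall
        exact hor.elim (· (Set.ncard_eq_one.2 ⟨p, Set.eq_singleton_iff_unique_mem.2 ⟨hpv, hall⟩⟩))
          (· hp)
      have hsub : bdry G (rotate G par v p) p ⊆ insert v (bdry G par p \ {a}) := by
        intro x hx
        refine (h.bdry_rotate_parent_subset hvp hx).imp id fun hxp => ⟨hxp, ?_⟩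
        rintro rfl
        exact h.notMem_bdry_rotate_parent hG.isAcyclic h2 hvp ha hap hx
      have h1 := Set.ncard_le_ncard hsub (Set.toFinite _)
      have h3 := Set.ncard_insert_le v (bdry G par p \ {a})
      have h4 := Set.ncard_sdiff_singleton_add_one (h.mem_bdry_parent hvp ha hap)
        (Set.toFinite _)
      omega
    · have h1 := Set.ncard_le_ncard (h.bdry_rotate_parent_subset hvp) (Set.toFinite _)
      have h3 := Set.ncard_insert_le v (bdry G par p)
      have h4 := h2 p
      omega
end
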